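/- For every u in the class N_* (equivalently, for every u in X_A), one has the Poincaré inequality with monomial Gaussian weight: ∫_{ℝ^N_*} |∇u|² dμ_A ≥ ∫_{ℝ^N_*} |u − ∫_{ℝ^N_*} u dμ_A|² dμ_A. -/

import Mathlib

open MeasureTheory Real

noncomputable section

/-- The Weyl chamber associated to the monomial weight with exponents `α`. -/
def chamber {N : ℕ} (α : Fin N → ℝ) : Set (EuclideanSpace ℝ (Fin N)) :=
  {x | ∀ i, 0 < α i → 0 < x i}

/-- The monomial weight `x^A = x₁^{α₁} ⋯ x_N^{α_N}`. -/
def monWeight {N : ℕ} (α : Fin N → ℝ) (x : EuclideanSpace ℝ (Fin N)) : ℝ :=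
  ∏ i, x i ^ α i

/-- The monomial Gaussian probability measure
`dμ_A = x^A e^{-|x|²/2} dx / ∫_{ℝ^N_*} x^A e^{-|x|²/2} dx` on the Weyl chamber. -/
def monGauss {N : ℕ} (α : Fin N → ℝ) : Measure (EuclideanSpace ℝ (Fin N)) :=
  (((MeasureTheory.volume.restrict (chamber α)).withDensity
      (fun x => ENNReal.ofReal (monWeight α x * Real.exp (-‖x‖ ^ 2 / 2)))) Set.univ)⁻¹ •
  ((MeasureTheory.volume.restrict (chamber α)).withDensity
      (fun x => ENNReal.ofReal (monWeight α x * Real.exp (-‖x‖ ^ 2 / 2))))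

/-- Membership in the class `N_*`: smooth, compactly supported, with vanishing normal
component of the gradient on the boundary of the Weyl chamber. -/
def NstarClass {N : ℕ} (α : Fin N → ℝ) (u : EuclideanSpace ℝ (Fin N) → ℝ) : Prop :=
  ContDiff ℝ (⊤ : ℕ∞) u ∧ HasCompactSupport u ∧
    ∀ x : EuclideanSpace ℝ (Fin N), ∀ i, 0 < α i → x i = 0 →
      fderiv ℝ u x (EuclideanSpace.single i 1) = 0

end

open Set Filter Topology

/-- If `φ` is an increasing solution of `(φ' w)' = -l φ w` vanishing at `x₀`, then
`∫ v'² w ≥ l ∫ v² w` for functions `v` vanishing at `x₀`. -/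
theorem integral_energy_nonneg {φ g w h v v' : ℝ → ℝ} {l a b x₀ : ℝ}
    (hx₀ : x₀ ∈ Ioo a b) (hφ₀ : φ x₀ = 0) (hg₀ : g x₀ ≠ 0) (hv₀ : v x₀ = 0)
    (hφa : φ a < 0) (hφb : 0 < φ b) (hφ : ∀ x ∈ Icc a b, x ≠ x₀ → φ x ≠ 0)
    (hφc : ContinuousOn φ (Icc a b)) (hhc : ContinuousOn h (Icc a b))
    (hvc : ContinuousOn v (Icc a b))
    (hha : 0 ≤ h a) (hhb : 0 ≤ h b)
    (hgw : ∀ x ∈ Ioo a b, h x = g x * w x) (hw : ∀ x ∈ Ioo a b, 0 ≤ w x)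
    (hφd : ∀ x ∈ Ioo a b, HasDerivAt φ (g x) x)
    (hhd : ∀ x ∈ Ioo a b, HasDerivAt h (-l * φ x * w x) x)
    (hvd : ∀ x ∈ Ioo a b, HasDerivAt v (v' x) x)
    (hψ : IntegrableOn (fun x => v' x ^ 2 * w x - l * (v x ^ 2 * w x)) (Icc a b)) :
    0 ≤ ∫ x in a..b, (v' x ^ 2 * w x - l * (v x ^ 2 * w x)) := by
  have hab : a ≤ b := (hx₀.1.trans hx₀.2).le
  set F : ℝ → ℝ := fun x => v x * (v x / φ x * h x) with hF
  have hF₀ : HasDerivAt F (v' x₀ ^ 2 * w x₀) x₀ := by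
    have hv := hvd x₀ hx₀
    have hp := hφd x₀ hx₀
    have hh := (hhd x₀ hx₀).continuousAt
    rw [hasDerivAt_iff_tendsto_slope] at hv hp ⊢
    have hquot : Tendsto (fun x => slope v x₀ x / slope φ x₀ x) (𝓝[≠] x₀)
        (𝓝 (v' x₀ / g x₀)) := hv.div hp hg₀
    have hlim := hv.mul (hquot.mul (hh.tendsto.mono_left nhdsWithin_le_nhds))
    have hval : v' x₀ * (v' x₀ / g x₀ * h x₀) = v' x₀ ^ 2 * w x₀ := by
      rw [hgw x₀ hx₀]; field_simp
    rw [hval] at hlim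
    refine hlim.congr' ?_
    filter_upwards [self_mem_nhdsWithin] with x hx
    have hx' : x - x₀ ≠ 0 := sub_ne_zero.2 hx
    simp only [slope_def_field, hF, hφ₀, hv₀, sub_zero, zero_mul]
    rw [div_div_div_cancel_right₀ hx']
    ring
  have hFd : ∀ x ∈ Ioo a b, x ≠ x₀ →
      HasDerivAt F (v' x * (v x / φ x * h x) + v x *
        ((v' x * φ x - v x * g x) / φ x ^ 2 * h x + v x / φ x * (-l * φ x * w x))) x := by
    intro x hx hne
    exact (hvd x hx).mul (((hvd x hx).div (hφd x hx) (hφ x (Ioo_subset_Icc_self hx) hne)).mul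
      (hhd x hx))
  have hFc : ContinuousOn F (Icc a b) := by
    intro x hx
    rcases eq_or_ne x x₀ with rfl | hne
    · exact hF₀.continuousAt.continuousWithinAt
    · exact (hvc x hx).mul (((hvc x hx).div (hφc x hx) (hφ x hx hne)).mul (hhc x hx))
  set F' : ℝ → ℝ := fun x => if x = x₀ then v' x₀ ^ 2 * w x₀ else
      v' x * (v x / φ x * h x) + v x *
        ((v' x * φ x - v x * g x) / φ x ^ 2 * h x + v x / φ x * (-l * φ x * w x)) with hF'
  have key := intervalIntegral.sub_le_integral_of_hasDeriv_right_of_le (g := F) (g' := F') hab hFc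
    (fun x hx => ?_) hψ (fun x hx => ?_)
  · refine le_trans ?_ key
    have h1 : F a ≤ 0 := by
      have : F a = v a ^ 2 * h a / φ a := by simp only [hF]; ring
      rw [this]
      exact div_nonpos_of_nonneg_of_nonpos (by positivity) hφa.le
    have h2 : 0 ≤ F b := by
      have : F b = v b ^ 2 * h b / φ b := by simp only [hF]; ring
      rw [this]
      positivity
    linarith
  · by_cases hxe : x = x₀
    · subst hxe
      simpa [hF'] using hF₀.hasDerivWithinAt
    · simpa [hF', hxe] using (hFd x hx hxe).hasDerivWithinAt
  · by_cases hxe : x = x₀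
    · subst hxe
      simp [hF', hv₀]
    · have hp := hφ x (Ioo_subset_Icc_self hx) hxe
      have hsq := mul_nonneg (hw x hx) (sq_nonneg (v' x - v x * g x / φ x))
      simp only [hF', hxe, if_false]
      rw [hgw x hx]
      have : v' x ^ 2 * w x - l * (v x ^ 2 * w x) - (v' x * (v x / φ x * (g x * w x)) + v x *
        ((v' x * φ x - v x * g x) / φ x ^ 2 * (g x * w x) + v x / φ x * (-l * φ x * w x)))
          = w x * (v' x - v x * g x / φ x) ^ 2 := by
        field_simp
        ring
      linarith

/-- One-dimensional monomial Gaussian density, extended by zero outside the chamber. -/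
noncomputable def lineDensity (a : ℝ) : ℝ → ℝ :=
  {x : ℝ | 0 < a → 0 < x}.indicator fun x => x ^ a * rexp (-x ^ 2 / 2)

theorem lineDensity_of_pos {a : ℝ} (ha : 0 < a) :
    lineDensity a = (Ioi 0).indicator fun x => x ^ a * rexp (-x ^ 2 / 2) := by
  simp [lineDensity, ha, Ioi_def]

theorem lineDensity_zero : lineDensity 0 = fun x => rexp (-x ^ 2 / 2) := by
  simp [lineDensity]

theorem lineDensity_nonneg {a : ℝ} (ha : 0 ≤ a) (x : ℝ) : 0 ≤ lineDensity a x := by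
  rcases ha.eq_or_lt with rfl | ha
  · rw [lineDensity_zero]; positivity
  · rw [lineDensity_of_pos ha]
    exact indicator_nonneg (fun x hx => by have : 0 < x := hx; positivity) x

theorem integrable_lineDensity {a : ℝ} (ha : 0 ≤ a) : Integrable (lineDensity a) := by
  have hexp : ∀ x : ℝ, rexp (-x ^ 2 / 2) = rexp (-(1 / 2) * x ^ 2) := fun x => by ring_nf
  rcases ha.eq_or_lt with rfl | ha
  · rw [lineDensity_zero]
    simp_rw [hexp]
    exact integrable_exp_neg_mul_sq (by norm_num)
  · rw [lineDensity_of_pos ha, integrable_indicator_iff measurableSet_Ioi]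
    simp_rw [hexp]
    exact integrableOn_rpow_mul_exp_neg_mul_sq (by norm_num) (by linarith)

theorem integral_lineDensity_pos {a : ℝ} (ha : 0 ≤ a) : 0 < ∫ x, lineDensity a x := by
  rw [integral_pos_iff_support_of_nonneg (lineDensity_nonneg ha) (integrable_lineDensity ha)]
  refine lt_of_lt_of_le (b := volume (Ioi (0 : ℝ))) (by simp) (measure_mono fun x hx => ?_)
  have hx : (0 : ℝ) < x := hx
  have : 0 < x ^ a * rexp (-x ^ 2 / 2) := by positivity
  rw [Function.mem_support, lineDensity,
    indicator_of_mem (show x ∈ {x : ℝ | 0 < a → 0 < x} from fun _ => hx)]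
  exact this.ne'

theorem integrable_mul_lineDensity {a : ℝ} (ha : 0 ≤ a) {f : ℝ → ℝ} (hf : Measurable f)
    {C : ℝ} (hC : ∀ x, |f x| ≤ C) : Integrable fun x => f x * lineDensity a x :=
  (integrable_lineDensity ha).bdd_mul hf.aestronglyMeasurable (ae_of_all _ hC)

theorem hasDerivAt_exp_neg_sq_half (x : ℝ) :
    HasDerivAt (fun x : ℝ => rexp (-x ^ 2 / 2)) (-x * rexp (-x ^ 2 / 2)) x := by
  have h := ((((hasDerivAt_id x).pow 2).neg).div_const 2).exp
  convert! h using 1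
  simp; ring

theorem exists_integral_sq_sub_mul_lineDensity_le {a : ℝ} (ha : 0 ≤ a) {u : ℝ → ℝ}
    (hu : Differentiable ℝ u) {B C : ℝ} (hB : ∀ x, |u x| ≤ B) (hC : ∀ x, |deriv u x| ≤ C) :
    ∃ c, ∫ x, (u x - c) ^ 2 * lineDensity a x ≤ ∫ x, deriv u x ^ 2 * lineDensity a x := by
  have hi₁ : Integrable fun x => deriv u x ^ 2 * lineDensity a x :=
    integrable_mul_lineDensity ha ((measurable_deriv u).pow_const 2) (C := C ^ 2) fun x => by
      rw [abs_pow]; exact pow_le_pow_left₀ (abs_nonneg _) (hC x) 2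
  have hi₂ : ∀ c, Integrable fun x => (u x - c) ^ 2 * lineDensity a x := fun c =>
    integrable_mul_lineDensity ha ((hu.continuous.measurable.sub_const c).pow_const 2)
      (C := (B + |c|) ^ 2) fun x => by
        rw [abs_pow]
        exact pow_le_pow_left₀ (abs_nonneg _) ((abs_sub _ _).trans (by linarith [hB x])) 2
  rcases ha.eq_or_lt with rfl | ha
  · refine ⟨u 0, sub_nonneg.1 ?_⟩
    rw [← integral_sub hi₁ (hi₂ _)]
    refine ge_of_tendsto (intervalIntegral_tendsto_integral (hi₁.sub (hi₂ _))
      tendsto_neg_atTop_atBot tendsto_id) ?_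
    filter_upwards [eventually_gt_atTop 0] with R hR
    have key := integral_energy_nonneg (φ := id) (g := fun _ => 1) (w := lineDensity 0)
      (h := lineDensity 0) (v := fun x => u x - u 0) (v' := deriv u) (l := 1) (a := -R) (b := R)
      (x₀ := 0) ⟨by linarith, hR⟩ rfl one_ne_zero (sub_self _) (by simpa) (by simpa)
      (fun x _ h => h) continuousOn_id (by rw [lineDensity_zero]; fun_prop)
      (hu.continuous.sub continuous_const).continuousOn
      (lineDensity_nonneg le_rfl _) (lineDensity_nonneg le_rfl _) (fun x _ => by simp)
      (fun x _ => lineDensity_nonneg le_rfl _) (fun x _ => hasDerivAt_id x)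
      (fun x _ => by simpa [lineDensity_zero] using hasDerivAt_exp_neg_sq_half x)
      (fun x _ => (hu x).hasDerivAt.sub_const _)
      (by simp only [one_mul]; exact (hi₁.sub (hi₂ (u 0))).integrableOn)
    simpa using key
  · set x₀ := √(a + 1)
    have hx₀p : 0 < x₀ := by positivity
    have hsq : x₀ ^ 2 = a + 1 := Real.sq_sqrt (by linarith)
    refine ⟨u x₀, ?_⟩
    set c := u x₀
    have hnn : 0 ≤ ∫ x, (u x - c) ^ 2 * lineDensity a x :=
      integral_nonneg fun x => mul_nonneg (sq_nonneg _) (lineDensity_nonneg ha.le x)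
    suffices 0 ≤ ∫ x, (deriv u x ^ 2 * lineDensity a x -
        2 * ((u x - c) ^ 2 * lineDensity a x)) by
      rw [integral_sub hi₁ ((hi₂ c).const_mul 2), integral_const_mul] at this
      linarith
    have hi := hi₁.sub ((hi₂ c).const_mul 2)
    have hsupp : (∫ x, (deriv u x ^ 2 * lineDensity a x -
        2 * ((u x - c) ^ 2 * lineDensity a x))) = ∫ x in Ioi 0, (deriv u x ^ 2 * lineDensity a x -
        2 * ((u x - c) ^ 2 * lineDensity a x)) := by
      refine (setIntegral_eq_integral_of_forall_compl_eq_zero fun x hx => ?_).symm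
      simp [lineDensity_of_pos ha, indicator_of_notMem hx]
    rw [hsupp]
    refine ge_of_tendsto (intervalIntegral_tendsto_integral_Ioi 0 hi.integrableOn tendsto_id) ?_
    filter_upwards [eventually_gt_atTop x₀] with R hR
    have hwx : ∀ x, 0 < x → lineDensity a x = x ^ a * rexp (-x ^ 2 / 2) := fun x hx => by
      rw [lineDensity_of_pos ha, indicator_of_mem (mem_Ioi.2 hx)]
    refine integral_energy_nonneg (φ := fun x => x ^ 2 - (a + 1)) (g := fun x => 2 * x)
      (h := fun x => 2 * (x ^ (a + 1) * rexp (-x ^ 2 / 2))) (x₀ := x₀) ⟨hx₀p, hR⟩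
      (by simp [hsq]) (by simp [hx₀p.ne']) (sub_self _) (by simp; linarith)
      (by have := pow_lt_pow_left₀ hR hx₀p.le two_ne_zero; simp; linarith) ?_ (by fun_prop) ?_
      (hu.continuous.sub continuous_const).continuousOn
      ?_ ?_ ?_ (fun x _ => lineDensity_nonneg ha.le _) ?_ ?_
      (fun x _ => (hu x).hasDerivAt.sub_const _) hi.integrableOn
    · intro x hx hne h0
      refine hne ?_
      have : x ^ 2 = x₀ ^ 2 := by rw [hsq]; linarith
      exact (pow_left_inj₀ hx.1 hx₀p.le two_ne_zero).1 this
    · refine Continuous.continuousOn (continuous_const.mul (Continuous.mul ?_ (by fun_prop)))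
      exact Real.continuous_rpow_const (by linarith)
    · simp [Real.zero_rpow (by linarith : a + 1 ≠ 0)]
    · have : 0 < R := hx₀p.trans hR
      positivity
    · intro x hx
      rw [hwx x hx.1, Real.rpow_add_one hx.1.ne']
      ring
    · intro x hx
      simpa using ((hasDerivAt_id x).pow 2).sub_const (a + 1)
    · intro x hx
      have h1 := (Real.hasDerivAt_rpow_const (p := a + 1) (Or.inl hx.1.ne')).mul
        (hasDerivAt_exp_neg_sq_half x)
      convert! h1.const_mul 2 using 1
      rw [hwx x hx.1, Real.rpow_add_one hx.1.ne', add_sub_cancel_right]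
      ring

theorem integrable_of_forall_abs_le {X : Type*} [MeasurableSpace X] {ν : Measure X}
    [IsFiniteMeasure ν] {f : X → ℝ} (hf : Measurable f) {C : ℝ} (hC : ∀ x, |f x| ≤ C) :
    Integrable f ν :=
  ⟨hf.aestronglyMeasurable, .of_bounded (ae_of_all _ hC)⟩

theorem abs_sq_le_sq {y C : ℝ} (h : |y| ≤ C) : |y ^ 2| ≤ C ^ 2 := by
  rw [abs_pow]; exact pow_le_pow_left₀ (abs_nonneg _) h 2

theorem integral_sub_const_sq {X : Type*} [MeasurableSpace X] {ν : Measure X}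
    [IsProbabilityMeasure ν] {f : X → ℝ} (hf : Integrable f ν)
    (hf2 : Integrable (fun x => f x ^ 2) ν) (m : ℝ) :
    ∫ x, (f x - m) ^ 2 ∂ν = ∫ x, (f x - ∫ y, f y ∂ν) ^ 2 ∂ν + (∫ x, f x ∂ν - m) ^ 2 := by
  have h : ∀ c : ℝ, ∫ x, (f x - c) ^ 2 ∂ν = ∫ x, f x ^ 2 ∂ν - 2 * c * ∫ x, f x ∂ν + c ^ 2 := by
    intro c
    have : ∀ x, (f x - c) ^ 2 = f x ^ 2 - 2 * c * f x + c ^ 2 := fun x => by ring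
    simp_rw [this]
    have h' : Integrable (fun x => f x ^ 2 - 2 * c * f x) ν := hf2.sub (hf.const_mul _)
    rw [integral_add h' (integrable_const _), integral_sub hf2 (hf.const_mul _), integral_const_mul]
    simp
  rw [h, h]
  ring

theorem sq_integral_le_integral_sq {X : Type*} [MeasurableSpace X] {ν : Measure X}
    [IsProbabilityMeasure ν] {f : X → ℝ} (hf : Integrable f ν)
    (hf2 : Integrable (fun x => f x ^ 2) ν) :
    (∫ x, f x ∂ν) ^ 2 ≤ ∫ x, f x ^ 2 ∂ν := by
  have h := integral_sub_const_sq hf hf2 0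
  simp only [sub_zero] at h
  have : 0 ≤ ∫ x, (f x - ∫ y, f y ∂ν) ^ 2 ∂ν := integral_nonneg fun x => sq_nonneg _
  linarith

/-- The Poincaré inequality with constant one, for bounded Lipschitz functions on the line. -/
def SatisfiesPoincare (μ : Measure ℝ) : Prop :=
  ∀ u : ℝ → ℝ, Differentiable ℝ u → (∃ B, ∀ x, |u x| ≤ B) → (∃ C, LipschitzWith C u) →
    ∫ x, (u x - ∫ y, u y ∂μ) ^ 2 ∂μ ≤ ∫ x, deriv u x ^ 2 ∂μ

theorem dist_finCons_right {n : ℕ} (t : ℝ) (y z : Fin n → ℝ) :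
    dist (Fin.cons t y : Fin (n + 1) → ℝ) (Fin.cons t z) ≤ dist y z := by
  refine (dist_pi_le_iff dist_nonneg).2 fun i => ?_
  cases i using Fin.cases with
  | zero => simp
  | succ i => simpa using dist_le_pi_dist y z i

theorem dist_finCons_left {n : ℕ} (s t : ℝ) (y : Fin n → ℝ) :
    dist (Fin.cons s y : Fin (n + 1) → ℝ) (Fin.cons t y) ≤ dist s t := by
  refine (dist_pi_le_iff dist_nonneg).2 fun i => ?_
  cases i using Fin.cases with
  | zero => simp
  | succ i => simp

theorem lipschitzWith_comp_finCons_right {n : ℕ} {u : (Fin (n + 1) → ℝ) → ℝ} {C : NNReal}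
    (hC : LipschitzWith C u) (t : ℝ) : LipschitzWith C fun y : Fin n → ℝ => u (Fin.cons t y) :=
  LipschitzWith.of_dist_le_mul fun y z => (hC.dist_le_mul _ _).trans
    (mul_le_mul_of_nonneg_left (dist_finCons_right t y z) C.2)

theorem lipschitzWith_comp_finCons_left {n : ℕ} {u : (Fin (n + 1) → ℝ) → ℝ} {C : NNReal}
    (hC : LipschitzWith C u) (y : Fin n → ℝ) : LipschitzWith C fun t : ℝ => u (Fin.cons t y) :=
  LipschitzWith.of_dist_le_mul fun s t => (hC.dist_le_mul _ _).trans
    (mul_le_mul_of_nonneg_left (dist_finCons_left s t y) C.2)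

theorem hasFDerivAt_finCons_right {n : ℕ} (t : ℝ) (y : Fin n → ℝ) :
    HasFDerivAt (fun y : Fin n → ℝ => (Fin.cons t y : Fin (n + 1) → ℝ))
      ((0 : (Fin n → ℝ) →L[ℝ] ℝ).finCons (ContinuousLinearMap.id ℝ (Fin n → ℝ))) y :=
  (hasFDerivAt_const t y).finCons (hasFDerivAt_id y)

theorem differentiable_comp_finCons_right {n : ℕ} {u : (Fin (n + 1) → ℝ) → ℝ}
    (hu : Differentiable ℝ u) (t : ℝ) : Differentiable ℝ fun y : Fin n → ℝ => u (Fin.cons t y) :=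
  fun y => ((hu _).hasFDerivAt.comp y (hasFDerivAt_finCons_right t y)).differentiableAt

theorem fderiv_comp_finCons_right {n : ℕ} {u : (Fin (n + 1) → ℝ) → ℝ} (hu : Differentiable ℝ u)
    (t : ℝ) (y : Fin n → ℝ) (i : Fin n) :
    fderiv ℝ (fun y : Fin n → ℝ => u (Fin.cons t y)) y (Pi.single i 1) =
      fderiv ℝ u (Fin.cons t y) (Pi.single i.succ 1) := by
  have h := (hu (Fin.cons t y)).hasFDerivAt.comp y (hasFDerivAt_finCons_right t y)
  rw [Function.comp_def] at h
  rw [h.fderiv, ContinuousLinearMap.comp_apply]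
  congr 1
  ext j
  cases j using Fin.cases with
  | zero => simp
  | succ j => simp [Pi.single_apply]

theorem hasDerivAt_comp_finCons_left {n : ℕ} {u : (Fin (n + 1) → ℝ) → ℝ}
    (hu : Differentiable ℝ u) (t : ℝ) (y : Fin n → ℝ) :
    HasDerivAt (fun t : ℝ => u (Fin.cons t y))
      (fderiv ℝ u (Fin.cons t y) (Pi.single 0 1)) t := by
  have h : HasDerivAt (fun t : ℝ => (Fin.cons t y : Fin (n + 1) → ℝ)) (Pi.single 0 1) t := by
    rw [hasDerivAt_pi]
    intro j
    cases j using Fin.cases with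
    | zero => simpa using hasDerivAt_id' t
    | succ j => simpa using hasDerivAt_const t (y j)
  exact (hu _).hasFDerivAt.comp_hasDerivAt t h

theorem abs_fderiv_single_le {n : ℕ} {u : (Fin n → ℝ) → ℝ} {C : NNReal}
    (hC : LipschitzWith C u) (x : Fin n → ℝ) (i : Fin n) :
    |fderiv ℝ u x (Pi.single i 1)| ≤ C := by
  have h := (fderiv ℝ u x).le_opNorm (Pi.single i 1)
  rw [Pi.norm_single, norm_one, mul_one] at h
  exact h.trans (norm_fderiv_le_of_lipschitz ℝ hC)

theorem measurable_finCons {n : ℕ} :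
    Measurable fun p : ℝ × (Fin n → ℝ) => (Fin.cons p.1 p.2 : Fin (n + 1) → ℝ) := by
  refine measurable_pi_lambda _ fun i => ?_
  cases i using Fin.cases with
  | zero => simpa using measurable_fst
  | succ i => simpa using (by fun_prop : Measurable fun p : ℝ × (Fin n → ℝ) => p.2 i)

theorem integral_pi_succ {n : ℕ} (μ : Fin (n + 1) → Measure ℝ) [∀ i, IsProbabilityMeasure (μ i)]
    {f : (Fin (n + 1) → ℝ) → ℝ} (hf : Measurable f) {C : ℝ} (hC : ∀ x, |f x| ≤ C) :
    ∫ x, f x ∂(Measure.pi μ) =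
      ∫ t, ∫ y, f (Fin.cons t y) ∂(Measure.pi fun i : Fin n => μ i.succ) ∂(μ 0) := by
  have h := (measurePreserving_piFinSuccAbove μ 0).symm.integral_comp' f
  rw [← h, integral_prod]
  · simp [MeasurableEquiv.piFinSuccAbove_symm_apply, Fin.insertNthEquiv]
  · exact integrable_of_forall_abs_le (hf.comp (MeasurableEquiv.measurable _)) fun p => hC _

theorem SatisfiesPoincare.pi {n : ℕ} (μ : Fin n → Measure ℝ) [∀ i, IsProbabilityMeasure (μ i)]
    (hμ : ∀ i, SatisfiesPoincare (μ i)) {u : (Fin n → ℝ) → ℝ} (hu : Differentiable ℝ u)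
    {B : ℝ} (hB : ∀ x, |u x| ≤ B) {C : NNReal} (hC : LipschitzWith C u) :
    ∫ x, (u x - ∫ y, u y ∂(Measure.pi μ)) ^ 2 ∂(Measure.pi μ) ≤
      ∑ i, ∫ x, fderiv ℝ u x (Pi.single i 1) ^ 2 ∂(Measure.pi μ) := by
  induction n with
  | zero =>
    have h : ∀ x, u x = u 0 := fun x => congrArg u (Subsingleton.elim _ _)
    simp [h]
  | succ n ih =>
    set ν := Measure.pi fun i : Fin n => μ i.succ
    set U : ℝ → ℝ := fun t => ∫ y, u (Fin.cons t y) ∂ν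
    set D : Fin (n + 1) → (Fin (n + 1) → ℝ) → ℝ := fun i x => fderiv ℝ u x (Pi.single i 1)
    have hum : Measurable u := hu.continuous.measurable
    have hDm : ∀ i, Measurable (D i) := fun i => measurable_fderiv_apply_const ℝ u _
    have hDC : ∀ i x, |D i x| ≤ C := fun i x => abs_fderiv_single_le hC x i
    have hslice : ∀ {f : (Fin (n + 1) → ℝ) → ℝ}, Measurable f → ∀ t,
        Measurable fun y => f (Fin.cons t y) := fun hf t =>
      hf.comp (measurable_finCons.comp measurable_prodMk_left)
    have hmarg : ∀ {f : (Fin (n + 1) → ℝ) → ℝ}, Measurable f →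
        Measurable fun t => ∫ y, f (Fin.cons t y) ∂ν := fun hf =>
      (StronglyMeasurable.integral_prod_right'
        (hf.comp measurable_finCons).stronglyMeasurable).measurable
    have habs : ∀ {X : Type} [MeasurableSpace X] (ρ : Measure X) [IsProbabilityMeasure ρ]
        {f : X → ℝ} {K : ℝ}, (∀ x, |f x| ≤ K) → |∫ x, f x ∂ρ| ≤ K := fun ρ _ f K h => by
      simpa using norm_integral_le_of_norm_le_const (μ := ρ) (f := f) (ae_of_all _ h)
    have hUB : ∀ t, |U t| ≤ B := fun t => habs ν fun y => hB _
    have hUd : ∀ t, HasDerivAt U (∫ y, D 0 (Fin.cons t y) ∂ν) t := fun t =>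
      (hasDerivAt_integral_of_dominated_loc_of_lip (s := univ) (bound := fun _ => (C : ℝ))
        univ_mem (.of_forall fun s => (hslice hum s).aestronglyMeasurable)
        (integrable_of_forall_abs_le (hslice hum t) fun y => hB _)
        (hslice (hDm 0) t).aestronglyMeasurable
        (ae_of_all _ fun y => by simpa using lipschitzWith_comp_finCons_left hC y)
        (integrable_const _)
        (ae_of_all _ fun y => hasDerivAt_comp_finCons_left hu t y)).2
    have hUL : LipschitzWith C U :=
      lipschitzWith_of_nnnorm_deriv_le (fun t => (hUd t).differentiableAt) fun t => by
        rw [(hUd t).deriv]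
        exact habs ν fun y => hDC _ _
    have hmean : ∫ x, u x ∂(Measure.pi μ) = ∫ t, U t ∂(μ 0) := integral_pi_succ μ hum hB
    set m := ∫ t, U t ∂(μ 0)
    have hUm : Measurable U := hmarg hum
    have hU1 : Integrable (fun t => (U t - m) ^ 2) (μ 0) :=
      integrable_of_forall_abs_le ((hUm.sub_const m).pow_const 2) (C := (B + |m|) ^ 2) fun t =>
        abs_sq_le_sq ((abs_sub _ _).trans (by linarith [hUB t]))
    have hD2 : ∀ i t, Integrable (fun y => D i (Fin.cons t y) ^ 2) ν := fun i t =>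
      integrable_of_forall_abs_le ((hslice (hDm i) t).pow_const 2) fun y => abs_sq_le_sq (hDC _ _)
    have hDI : ∀ i, Integrable (fun t => ∫ y, D i (Fin.cons t y) ^ 2 ∂ν) (μ 0) := fun i =>
      integrable_of_forall_abs_le (hmarg ((hDm i).pow_const 2)) fun t =>
        habs ν fun y => abs_sq_le_sq (hDC i (Fin.cons t y))
    have hsq : ∀ i, ∫ x, D i x ^ 2 ∂(Measure.pi μ) = ∫ t, ∫ y, D i (Fin.cons t y) ^ 2 ∂ν ∂(μ 0) :=
      fun i => integral_pi_succ μ ((hDm i).pow_const 2) fun x => abs_sq_le_sq (hDC i x)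
    have hsub : ∀ x, |u x - m| ≤ B + |m| := fun x => (abs_sub _ _).trans (by linarith [hB x])
    have hfib : ∀ t, ∫ y, (u (Fin.cons t y) - m) ^ 2 ∂ν ≤
        (∑ i : Fin n, ∫ y, D i.succ (Fin.cons t y) ^ 2 ∂ν) + (U t - m) ^ 2 := by
      intro t
      rw [integral_sub_const_sq
        (integrable_of_forall_abs_le (hslice hum t) fun y => hB _)
        (integrable_of_forall_abs_le ((hslice hum t).pow_const 2) fun y => abs_sq_le_sq (hB _))]
      have := ih (fun i => μ i.succ) (fun i => hμ _) (differentiable_comp_finCons_right hu t)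
        (fun y => hB _) (lipschitzWith_comp_finCons_right hC t)
      simp_rw [fderiv_comp_finCons_right hu] at this
      exact add_le_add_left this _
    have hbase : ∫ t, (U t - m) ^ 2 ∂(μ 0) ≤ ∫ t, ∫ y, D 0 (Fin.cons t y) ^ 2 ∂ν ∂(μ 0) := by
      refine (hμ 0 U (fun t => (hUd t).differentiableAt) ⟨B, hUB⟩ ⟨C, hUL⟩).trans ?_
      refine integral_mono_of_nonneg (ae_of_all _ fun t => sq_nonneg _) (hDI 0)
        (ae_of_all _ fun t => ?_)
      simp only [(hUd t).deriv]
      exact sq_integral_le_integral_sq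
        (integrable_of_forall_abs_le (hslice (hDm 0) t) fun y => hDC _ _) (hD2 0 t)
    rw [hmean, integral_pi_succ μ ((hum.sub_const m).pow_const 2) (fun x => abs_sq_le_sq (hsub x)),
      Fin.sum_univ_succ]
    calc ∫ t, ∫ y, (u (Fin.cons t y) - m) ^ 2 ∂ν ∂(μ 0)
        ≤ ∫ t, ((∑ i : Fin n, ∫ y, D i.succ (Fin.cons t y) ^ 2 ∂ν) + (U t - m) ^ 2) ∂(μ 0) :=
          integral_mono_of_nonneg (ae_of_all _ fun t => integral_nonneg fun y => sq_nonneg _)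
            ((integrable_finsetSum _ fun i _ => hDI i.succ).add hU1) (ae_of_all _ hfib)
      _ = (∑ i : Fin n, ∫ x, D i.succ x ^ 2 ∂(Measure.pi μ)) + ∫ t, (U t - m) ^ 2 ∂(μ 0) := by
          rw [integral_add (integrable_finsetSum _ fun i _ => hDI i.succ) hU1,
            integral_finsetSum _ fun i _ => hDI i.succ]
          simp_rw [hsq]
      _ ≤ _ := by
          rw [add_comm]
          refine add_le_add_left (hbase.trans_eq (hsq 0).symm) _

/-- The one-dimensional monomial Gaussian probability measure. -/
noncomputable def lineGauss (a : ℝ) : Measure ℝ :=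
  (ENNReal.ofReal (∫ x, lineDensity a x))⁻¹ •
    volume.withDensity fun x => ENNReal.ofReal (lineDensity a x)

theorem lineGauss_apply {a : ℝ} (ha : 0 ≤ a) {s : Set ℝ} (hs : MeasurableSet s) :
    lineGauss a s = (ENNReal.ofReal (∫ x, lineDensity a x))⁻¹ *
      ENNReal.ofReal (∫ x in s, lineDensity a x) := by
  rw [lineGauss, Measure.smul_apply, withDensity_apply _ hs, smul_eq_mul,
    ofReal_integral_eq_lintegral_ofReal (integrable_lineDensity ha).integrableOn
      (ae_of_all _ fun x => lineDensity_nonneg ha x)]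

theorem isProbabilityMeasure_lineGauss {a : ℝ} (ha : 0 ≤ a) :
    IsProbabilityMeasure (lineGauss a) := by
  refine ⟨?_⟩
  rw [lineGauss_apply ha .univ, setIntegral_univ, ENNReal.inv_mul_cancel]
  · simpa using integral_lineDensity_pos ha
  · simp

theorem measurable_lineDensity {a : ℝ} : Measurable (lineDensity a) := by
  refine Measurable.indicator (by fun_prop) ?_
  by_cases ha : 0 < a
  · simpa only [ha, true_imp_iff] using measurableSet_lt measurable_const measurable_id'
  · simp [ha]

theorem integral_lineGauss {a : ℝ} (ha : 0 ≤ a) (f : ℝ → ℝ) :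
    ∫ x, f x ∂(lineGauss a) = (∫ x, lineDensity a x)⁻¹ * ∫ x, f x * lineDensity a x := by
  rw [lineGauss, integral_smul_measure, integral_withDensity_eq_integral_toReal_smul
    measurable_lineDensity.ennreal_ofReal (by simp)]
  simp only [ENNReal.toReal_inv, ENNReal.toReal_ofReal (lineDensity_nonneg ha _), smul_eq_mul,
    ENNReal.toReal_ofReal (integral_lineDensity_pos ha).le, mul_comm (lineDensity a _)]

theorem satisfiesPoincare_lineGauss {a : ℝ} (ha : 0 ≤ a) : SatisfiesPoincare (lineGauss a) := by
  rintro u hu ⟨B, hB⟩ ⟨C, hC⟩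
  have := isProbabilityMeasure_lineGauss ha
  obtain ⟨c, hc⟩ := exists_integral_sq_sub_mul_lineDensity_le ha hu hB
    (C := C) fun x => norm_deriv_le_of_lipschitz hC
  have hum := hu.continuous.measurable
  have h := integral_sub_const_sq (integrable_of_forall_abs_le (ν := lineGauss a) hum hB)
    (integrable_of_forall_abs_le (hum.pow_const 2) fun x => abs_sq_le_sq (hB x)) c
  have h' : ∫ x, (u x - c) ^ 2 ∂(lineGauss a) ≤ ∫ x, deriv u x ^ 2 ∂(lineGauss a) := by
    rw [integral_lineGauss ha, integral_lineGauss ha]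
    exact mul_le_mul_of_nonneg_left hc (inv_nonneg.2 (integral_lineDensity_pos ha).le)
  nlinarith [sq_nonneg (∫ x, u x ∂(lineGauss a) - c)]

theorem setLIntegral_prod_lineDensity {N : ℕ} {α : Fin N → ℝ} (hα : ∀ i, 0 ≤ α i)
    (s : Fin N → Set ℝ) :
    ∫⁻ y in univ.pi s, ENNReal.ofReal (∏ i, lineDensity (α i) (y i)) =
      ∏ i, ENNReal.ofReal (∫ x in s i, lineDensity (α i) x) := by
  rw [volume_pi, Measure.restrict_pi_pi, ← ofReal_integral_eq_lintegral_ofReal,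
    integral_fintype_prod_eq_prod, ENNReal.ofReal_prod_of_nonneg]
  · exact fun i _ => integral_nonneg fun x => lineDensity_nonneg (hα i) x
  · exact Integrable.fintype_prod_dep fun i => (integrable_lineDensity (hα i)).integrableOn
  · exact ae_of_all _ fun y => Finset.prod_nonneg fun i _ => lineDensity_nonneg (hα i) _

theorem measurableSet_chamber {N : ℕ} (α : Fin N → ℝ) : MeasurableSet (chamber α) := by
  simp only [chamber, ofPred_forall]
  refine .iInter fun i => .iInter fun _ => measurableSet_lt measurable_const (by fun_prop)

theorem prod_lineDensity_eq_indicator {N : ℕ} (α : Fin N → ℝ) :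
    (fun x : EuclideanSpace ℝ (Fin N) => ENNReal.ofReal (∏ i, lineDensity (α i) (x i))) =
      (chamber α).indicator fun x =>
        ENNReal.ofReal (monWeight α x * Real.exp (-‖x‖ ^ 2 / 2)) := by
  ext x
  by_cases hx : x ∈ chamber α
  · rw [indicator_of_mem hx, monWeight, EuclideanSpace.norm_sq_eq, ← Finset.sum_neg_distrib,
      Finset.sum_div, Real.exp_sum, ← Finset.prod_mul_distrib]
    congr 2
    ext i
    rw [lineDensity, indicator_of_mem (show x i ∈ {t : ℝ | 0 < α i → 0 < t} from hx i)]
    simp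
  · rw [indicator_of_notMem hx]
    simp only [chamber, mem_ofPred_eq, not_forall] at hx
    obtain ⟨i, hi, hxi⟩ := hx
    rw [Finset.prod_eq_zero (Finset.mem_univ i), ENNReal.ofReal_zero]
    simp [lineDensity, hi, hxi]

theorem measurePreserving_toLp_monGauss {N : ℕ} {α : Fin N → ℝ} (hα : ∀ i, 0 ≤ α i) :
    MeasurePreserving (MeasurableEquiv.toLp 2 (Fin N → ℝ))
      (Measure.pi fun i => lineGauss (α i)) (monGauss α) := by
  have := fun i => isProbabilityMeasure_lineGauss (hα i)
  refine MeasurePreserving.symm (MeasurableEquiv.toLp 2 (Fin N → ℝ)).symm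
    (μa := monGauss α) ⟨MeasurableEquiv.measurable _, (Measure.pi_eq fun s hs => ?_).symm⟩
  set ρ := (volume.restrict (chamber α)).withDensity
      (fun x => ENNReal.ofReal (monWeight α x * Real.exp (-‖x‖ ^ 2 / 2))) with hρ
  have hbox : ∀ s : Fin N → Set ℝ, (∀ i, MeasurableSet (s i)) →
      ρ ((MeasurableEquiv.toLp 2 (Fin N → ℝ)).symm ⁻¹' univ.pi s) =
        ∏ i, ENNReal.ofReal (∫ x in s i, lineDensity (α i) x) := by
    intro s hs
    have hsm : MeasurableSet (univ.pi s) := .univ_pi hs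
    rw [hρ, ← withDensity_indicator (measurableSet_chamber α), ← prod_lineDensity_eq_indicator,
      withDensity_apply _ ((MeasurableEquiv.measurable _) hsm), ← setLIntegral_prod_lineDensity hα]
    refine (EuclideanSpace.volume_preserving_symm_measurableEquiv_toLp
      (Fin N)).setLIntegral_comp_preimage hsm (f := fun y : Fin N → ℝ =>
        ENNReal.ofReal (∏ i, lineDensity (α i) (y i))) ?_
    exact (Finset.measurable_prod _ fun i _ =>
      measurable_lineDensity.comp (measurable_pi_apply i)).ennreal_ofReal
  have huniv : ρ univ = ∏ i, ENNReal.ofReal (∫ x, lineDensity (α i) x) := by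
    simpa using hbox (fun _ => univ) fun _ => .univ
  rw [MeasurableEquiv.map_apply]
  change (ρ univ)⁻¹ • ρ _ = _
  rw [hbox s hs, huniv, smul_eq_mul, ENNReal.prod_inv_distrib, ← Finset.prod_mul_distrib]
  · exact Finset.prod_congr rfl fun i _ => (lineGauss_apply (hα i) (hs i)).symm
  · exact fun i _ j _ _ => Or.inr (by simp)

theorem norm_gradient_sq_eq_sum {N : ℕ} (u : EuclideanSpace ℝ (Fin N) → ℝ)
    (x : EuclideanSpace ℝ (Fin N)) :
    ‖gradient u x‖ ^ 2 = ∑ i, fderiv ℝ u x (EuclideanSpace.single i 1) ^ 2 := by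
  rw [EuclideanSpace.norm_sq_eq]
  refine Finset.sum_congr rfl fun i _ => ?_
  have h : fderiv ℝ u x (EuclideanSpace.single i 1) = gradient u x i := by
    rw [gradient, ← InnerProductSpace.toDual_symm_apply (𝕜 := ℝ),
      EuclideanSpace.inner_single_right]
    simp
  rw [h, Real.norm_eq_abs, sq_abs]

/-- Poincaré inequality with monomial Gaussian weight:
`∫ |∇u|² dμ_A ≥ ∫ |u − ∫ u dμ_A|² dμ_A` for every `u` in the class `N_*`. -/
theorem poincare_monomial_gaussian {N : ℕ} (hN : 1 ≤ N) (α : Fin N → ℝ)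
    (hα : ∀ i, 0 ≤ α i) (u : EuclideanSpace ℝ (Fin N) → ℝ) (hu : NstarClass α u) :
    ∫ x, ‖gradient u x‖ ^ 2 ∂(monGauss α) ≥
      ∫ x, (u x - ∫ y, u y ∂(monGauss α)) ^ 2 ∂(monGauss α) := by
  have := fun i => isProbabilityMeasure_lineGauss (hα i)
  obtain ⟨hsmooth, hsupp, -⟩ := hu
  set L := (EuclideanSpace.equiv (Fin N) ℝ).symm
  have hmp : ∀ f : EuclideanSpace ℝ (Fin N) → ℝ, ∫ x, f x ∂(monGauss α) =
      ∫ y, f (L y) ∂(Measure.pi fun i => lineGauss (α i)) := fun f =>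
    ((measurePreserving_toLp_monGauss hα).integral_comp' f).symm
  have hsmooth' : ContDiff ℝ (⊤ : ℕ∞) fun y => u (L y) := hsmooth.comp L.contDiff
  have hsupp' : HasCompactSupport fun y => u (L y) := hsupp.comp_homeomorph L.toHomeomorph
  obtain ⟨B, hB⟩ := hsmooth'.continuous.bounded_above_of_compact_support hsupp'
  obtain ⟨C, hC⟩ := hsmooth'.lipschitzWith_of_hasCompactSupport hsupp' (by simp)
  have hdiff : Differentiable ℝ fun y => u (L y) := hsmooth'.differentiable (by simp)
  have hgrad : ∀ y i, fderiv ℝ u (L y) (EuclideanSpace.single i 1) =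
      fderiv ℝ (fun y => u (L y)) y (Pi.single i 1) := by
    intro y i
    have h := (hsmooth.differentiable (by simp) (L y)).hasFDerivAt.comp y L.hasFDerivAt
    rw [Function.comp_def] at h
    rw [h.fderiv]
    rfl
  have key := SatisfiesPoincare.pi (fun i => lineGauss (α i))
    (fun i => satisfiesPoincare_lineGauss (hα i)) hdiff hB hC
  rw [hmp, hmp, hmp]
  simp_rw [norm_gradient_sq_eq_sum, hgrad]
  rw [integral_finsetSum _ fun i _ => integrable_of_forall_abs_le
    ((measurable_fderiv_apply_const ℝ _ _).pow_const 2)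
    fun y => abs_sq_le_sq (abs_fderiv_single_le hC y i)]
  exact key
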